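/- arXiv:math/0309368 — 2 statements merged into one kernel-verified Lean document; each statement's English description precedes it below -/
import Mathlib

section
/- Let T = (T_1,…,T_n) be a bilateral weighted shift on K_ω with bounded weights Λ = {λ_u}_{u∈F_ω} satisfying λ_u > 0 for all u, and let S = (S_1,…,S_n) be the unweighted shift on K_ω. Then the von Neumann algebra generated by {S_1,…,S_n} in B(K_ω) is contained in the von Neumann algebra generated by {T_1,…,T_n}. -/
open scoped ENNReal InnerProductSpace

noncomputable section

variable {n : ℕ}

/-- The element of the free group determined by a word (list of generators). -/
def wordProd (l : List (Fin n)) : FreeGroup (Fin n) := (l.map FreeGroup.of).prod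

/-- The initial segment `ω_m = i_1 i_2 ⋯ i_m` of an infinite word `ω`. -/
def initSeg (ω : ℕ → Fin n) (m : ℕ) : List (Fin n) := List.ofFn fun j : Fin m => ω j

/-- The set `F_ω = { v ω_m⁻¹ : v ∈ F_n^+, m ≥ 0 }` inside the free group. -/
def Fomega (ω : ℕ → Fin n) : Set (FreeGroup (Fin n)) :=
  {g | ∃ (v : List (Fin n)) (m : ℕ), g = wordProd v * (wordProd (initSeg ω m))⁻¹}

lemma genMul_mem (ω : ℕ → Fin n) (i : Fin n) {g : FreeGroup (Fin n)} (hg : g ∈ Fomega ω) :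
    FreeGroup.of i * g ∈ Fomega ω := by
  obtain ⟨v, m, rfl⟩ := hg
  exact ⟨i :: v, m, by simp [wordProd, mul_assoc]⟩

/-- `K_ω = ℓ²(F_ω)`. -/
abbrev Komega (ω : ℕ → Fin n) : Type _ := lp (fun _ : Fomega ω => ℂ) 2

/-- The standard orthonormal basis vector `ξ_u` of `K_ω`. -/
def xi (ω : ℕ → Fin n) (u : Fomega ω) : Komega ω := lp.single 2 u 1

/-- `iu` as an element of `F_ω`. -/
def gen (ω : ℕ → Fin n) (i : Fin n) (u : Fomega ω) : Fomega ω :=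
  ⟨FreeGroup.of i * u.1, genMul_mem ω i u.2⟩

/-- `T = (T_1,…,T_n)` is the bilateral weighted shift on `K_ω` with (complex) weights `Λ`:
`T_i ξ_u = λ_{iu} ξ_{iu}`. -/
def IsWeightedShift (ω : ℕ → Fin n) (Λ : Fomega ω → ℂ)
    (T : Fin n → Komega ω →L[ℂ] Komega ω) : Prop :=
  ∀ (i : Fin n) (u : Fomega ω), T i (xi ω u) = Λ (gen ω i u) • xi ω (gen ω i u)

/-- real-weight version -/
def IsWeightedShiftR (ω : ℕ → Fin n) (Λ : Fomega ω → ℝ)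
    (T : Fin n → Komega ω →L[ℂ] Komega ω) : Prop :=
  ∀ (i : Fin n) (u : Fomega ω), T i (xi ω u) = (Λ (gen ω i u) : ℂ) • xi ω (gen ω i u)

/-- A closed subspace `H` is reducing for an operator `A` if `H` and `Hᗮ` are `A`-invariant. -/
def Reduces {E : Type*} [NormedAddCommGroup E] [InnerProductSpace ℂ E]
    (A : E →L[ℂ] E) (H : Submodule ℂ E) : Prop :=
  (∀ x ∈ H, A x ∈ H) ∧ ∀ x ∈ Hᗮ, A x ∈ Hᗮ

/-- `w^k` for a finite word `w`. -/
def listPow (w : List (Fin n)) : ℕ → List (Fin n)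
  | 0 => []
  | k + 1 => w ++ listPow w k

/-- A word is primitive if it is non-empty and not a proper power. -/
def Primitive (v : List (Fin n)) : Prop :=
  v ≠ [] ∧ ∀ (w : List (Fin n)) (j : ℕ), 2 ≤ j → v ≠ listPow w j

/-- `ω = v v v ⋯`. -/
def IsPeriodicWord (ω : ℕ → Fin n) (v : List (Fin n)) : Prop :=
  v ≠ [] ∧ ∀ k : ℕ, initSeg ω (k * v.length) = listPow v k

/-- `ω = u v₀ v₀ v₀ ⋯` for some words `u, v₀` with `v₀` non-empty. -/
def EventuallyPeriodic (ω : ℕ → Fin n) : Prop :=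
  ∃ N p : ℕ, 1 ≤ p ∧ ∀ m ≥ N, ω (m + p) = ω m

def Aperiodic (ω : ℕ → Fin n) : Prop := ¬EventuallyPeriodic ω

/-- The von Neumann algebra generated by a set of bounded operators, realized via the
double commutant of the set together with its adjoints. -/
def vNGen {E : Type*} [NormedAddCommGroup E] [InnerProductSpace ℂ E] [CompleteSpace E]
    (A : Set (E →L[ℂ] E)) : Set (E →L[ℂ] E) :=
  Set.centralizer (Set.centralizer (A ∪ star '' A))

section WeightedShift

open ContinuousLinearMap

lemma inner_xi_left (ω : ℕ → Fin n) (u : Fomega ω) (f : Komega ω) :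
    ⟪xi ω u, f⟫_ℂ = f u := by
  simp [xi, lp.inner_single_left]

lemma xi_apply_self (ω : ℕ → Fin n) (u : Fomega ω) : xi ω u u = 1 := by
  simp [xi]

lemma xi_apply_of_ne (ω : ℕ → Fin n) {u v : Fomega ω} (h : v ≠ u) : xi ω u v = 0 := by
  simp [xi, h]

lemma gen_injective (ω : ℕ → Fin n) (i : Fin n) : Function.Injective (gen ω i) :=
  fun _ _ h => Subtype.ext (mul_left_cancel (congrArg Subtype.val h))

/-- Operators on `K_ω` that agree on the standard basis are equal. -/
lemma clm_ext_xi (ω : ℕ → Fin n) {A B : Komega ω →L[ℂ] Komega ω}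
    (h : ∀ u, A (xi ω u) = B (xi ω u)) : A = B := by
  refine lp.ext_continuousLinearMap (𝕜 := ℂ) (by simp) fun u => ?_
  refine ContinuousLinearMap.ext_ring ?_
  simpa [xi] using h u

variable {ω : ℕ → Fin n} {Λ : Fomega ω → ℝ} {T : Fin n → Komega ω →L[ℂ] Komega ω}

lemma IsWeightedShiftR.adjoint_apply (hT : IsWeightedShiftR ω Λ T) (i : Fin n)
    (f : Komega ω) (u : Fomega ω) :
    adjoint (T i) f u = Λ (gen ω i u) * f (gen ω i u) := by
  rw [← inner_xi_left, adjoint_inner_right, hT, inner_smul_left, inner_xi_left, Complex.conj_ofReal]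

lemma IsWeightedShiftR.adjoint_xi_gen (hT : IsWeightedShiftR ω Λ T) (i : Fin n) (u : Fomega ω) :
    adjoint (T i) (xi ω (gen ω i u)) = (Λ (gen ω i u) : ℂ) • xi ω u := by
  ext v
  rw [hT.adjoint_apply, lp.coeFn_smul, Pi.smul_apply, smul_eq_mul]
  rcases eq_or_ne v u with rfl | hv
  · simp only [xi_apply_self]
  · rw [xi_apply_of_ne ω hv, xi_apply_of_ne ω ((gen_injective ω i).ne hv), mul_zero, mul_zero]

lemma IsWeightedShiftR.apply_gen (hT : IsWeightedShiftR ω Λ T) (i : Fin n)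
    (f : Komega ω) (u : Fomega ω) :
    T i f (gen ω i u) = Λ (gen ω i u) * f u := by
  rw [← inner_xi_left, ← adjoint_inner_left, hT.adjoint_xi_gen, inner_smul_left, inner_xi_left,
    Complex.conj_ofReal]

lemma IsWeightedShiftR.apply_of_notMem_range (hT : IsWeightedShiftR ω Λ T) (i : Fin n)
    (f : Komega ω) {w : Fomega ω} (hw : w ∉ Set.range (gen ω i)) :
    T i f w = 0 := by
  have h : adjoint (T i) (xi ω w) = 0 := by
    ext v
    rw [hT.adjoint_apply, xi_apply_of_ne ω (fun hv => hw ⟨v, hv⟩), mul_zero]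
    rfl
  rw [← inner_xi_left, ← adjoint_inner_left, h, inner_zero_left]

/-- The matrix entries of an operator commuting with a positively weighted shift and its adjoint
are invariant under the shift, so the operator commutes with the unweighted shift. -/
lemma IsWeightedShiftR.commute_unweighted (hT : IsWeightedShiftR ω Λ T) (hpos : ∀ u, 0 < Λ u)
    {S : Fin n → Komega ω →L[ℂ] Komega ω} (hS : IsWeightedShiftR ω (fun _ => 1) S)
    {X : Komega ω →L[ℂ] Komega ω} {i : Fin n}
    (h : T i * X = X * T i) (h' : star (T i) * X = X * star (T i)) :
    S i * X = X * S i := by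
  have hne : ∀ u, (Λ u : ℂ) ≠ 0 := fun u => Complex.ofReal_ne_zero.mpr (hpos u).ne'
  refine clm_ext_xi ω fun v => ?_
  have hTX : T i (X (xi ω v)) = (Λ (gen ω i v) : ℂ) • X (xi ω (gen ω i v)) := by
    rw [← map_smul, ← hT]
    exact DFunLike.congr_fun h (xi ω v)
  have hTsX : adjoint (T i) (X (xi ω (gen ω i v))) = (Λ (gen ω i v) : ℂ) • X (xi ω v) := by
    rw [← map_smul, ← hT.adjoint_xi_gen]
    exact DFunLike.congr_fun h' (xi ω (gen ω i v))
  change S i (X (xi ω v)) = X (S i (xi ω v))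
  rw [hS, Complex.ofReal_one, one_smul]
  ext w
  have hw := congrArg (fun f : Komega ω => f w) hTX
  simp only [lp.coeFn_smul, Pi.smul_apply, smul_eq_mul] at hw
  by_cases hr : w ∈ Set.range (gen ω i)
  · obtain ⟨u, rfl⟩ := hr
    have hu := congrArg (fun f : Komega ω => f u) hTsX
    simp only [lp.coeFn_smul, Pi.smul_apply, smul_eq_mul] at hu
    rw [hT.apply_gen] at hw
    rw [hT.adjoint_apply] at hu
    rw [hS.apply_gen, Complex.ofReal_one, one_mul]
    have hsum : (Λ (gen ω i u) : ℂ) + Λ (gen ω i v) ≠ 0 := by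
      exact_mod_cast (add_pos (hpos _) (hpos _)).ne'
    refine mul_left_cancel₀ hsum ?_
    linear_combination hw - hu
  · rw [hT.apply_of_notMem_range i _ hr] at hw
    rw [hS.apply_of_notMem_range i _ hr]
    exact ((mul_eq_zero.mp hw.symm).resolve_left (hne _)).symm

end WeightedShift

/-- the von Neumann algebra generated by the unweighted shifts `S_i` is
contained in the von Neumann algebra generated by the weighted shifts `T_i`. -/
theorem vN_unweighted_le_vN_weighted
    {n : ℕ} (hn : 2 ≤ n) (ω : ℕ → Fin n)
    (Λ : Fomega ω → ℝ) (hbdd : ∃ C : ℝ, ∀ u, ‖Λ u‖ ≤ C) (hpos : ∀ u, 0 < Λ u)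
    (T : Fin n → Komega ω →L[ℂ] Komega ω) (hT : IsWeightedShiftR ω Λ T)
    (S : Fin n → Komega ω →L[ℂ] Komega ω) (hS : IsWeightedShiftR ω (fun _ => 1) S) :
    vNGen (Set.range S) ⊆ vNGen (Set.range T) := by
  have key : ∀ X ∈ Set.centralizer (Set.range T ∪ star '' Set.range T), ∀ i,
      S i * X = X * S i := fun X hX i =>
    hT.commute_unweighted hpos hS (hX _ (Or.inl ⟨i, rfl⟩)) (hX _ (Or.inr ⟨_, ⟨i, rfl⟩, rfl⟩))
  refine Set.centralizer_subset fun X hX => ?_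
  have hX' : star X ∈ Set.centralizer (Set.range T ∪ star '' Set.range T) := by
    rw [Set.image_star] at hX ⊢
    exact Set.star_mem_centralizer hX
  rintro _ (⟨i, rfl⟩ | ⟨_, ⟨i, rfl⟩, rfl⟩)
  · exact key X hX i
  · simpa using congrArg star (key (star X) hX' i).symm
end
end

section
/- Let ω be an infinite word, let Λ = {λ_u}_{u∈F_ω} be bounded weights with λ_u > 0, let S = (S_1,…,S_n) be the unweighted shift on K_ω, and let P_H be an orthogonal projection on K_ω commuting with every S_i. Let Π̄ be a partition of F_ω into non-empty subsets such that: (a) Q_J commutes with P_H for every J ∈ Π̄; (b) Π̄ refines the partition of F_ω into level sets {u : λ_u = r} of the weights; and (c) Π̄ is maximal with properties (a) and (b) under refinement (no strictly finer partition of F_ω has both properties). Then for every J ∈ Π̄ and every integer m ≥ 0 there is a unique word w ∈ F_n^+ with |w| = m such that w^{-1}J ∩ F_ω ≠ ∅; moreover w(w^{-1}J ∩ F_ω) = J, and for every v ∈ F_n^+ and every J_1 ∈ Π̄, if v·(w^{-1}J ∩ F_ω) ∩ J_1 ≠ ∅ then v·(w^{-1}J ∩ F_ω) = J_1. -/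
open scoped ENNReal InnerProductSpace

noncomputable section

variable {n : ℕ}

open Classical

/-- `Q` is the orthogonal projection of `K_ω` onto the closed span of `{ξ_u : u ∈ A}`
(a diagonal projection). This determines `Q` uniquely. -/
def IsDiagProj (ω : ℕ → Fin n) (A : Set (FreeGroup (Fin n)))
    (Q : Komega ω →L[ℂ] Komega ω) : Prop :=
  ∀ u : Fomega ω, Q (xi ω u) = if u.1 ∈ A then xi ω u else 0

/-- `wJ = { w g : g ∈ J }`. -/
def mulSet (w : List (Fin n)) (A : Set (FreeGroup (Fin n))) : Set (FreeGroup (Fin n)) :=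
  (fun g => wordProd w * g) '' A

/-- `w⁻¹J ∩ F_ω = { h ∈ F_ω : w h ∈ J }`. -/
def preSet (ω : ℕ → Fin n) (w : List (Fin n)) (A : Set (FreeGroup (Fin n))) :
    Set (FreeGroup (Fin n)) :=
  {h | h ∈ Fomega ω ∧ wordProd w * h ∈ A}

/-- A partition of the set `F_ω` into non-empty subsets. -/
def IsPartitionOfFomega (ω : ℕ → Fin n) (𝔓 : Set (Set (FreeGroup (Fin n)))) : Prop :=
  (∀ J ∈ 𝔓, J.Nonempty ∧ J ⊆ Fomega ω) ∧
  ∀ g ∈ Fomega ω, ∃! J, J ∈ 𝔓 ∧ g ∈ J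

/-- `𝔓₁` refines `𝔓₂`: every member of `𝔓₂` is a union of members of `𝔓₁`. -/
def RefinesPartition (𝔓₁ 𝔓₂ : Set (Set (FreeGroup (Fin n)))) : Prop :=
  ∀ J ∈ 𝔓₂, ∃ 𝒮 ⊆ 𝔓₁, J = ⋃₀ 𝒮

/-- A partition of `F_ω` such that (a) every `Q_J`, `J ∈ 𝔓`, commutes with `P`, and
(b) `𝔓` refines the partition of `F_ω` into level sets of the weights `Λ`. -/
def GoodPartition (ω : ℕ → Fin n) (Λ : Fomega ω → ℝ)
    (P : Komega ω →L[ℂ] Komega ω) (𝔓 : Set (Set (FreeGroup (Fin n)))) : Prop :=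
  IsPartitionOfFomega ω 𝔓 ∧
  (∀ J ∈ 𝔓, ∀ Q : Komega ω →L[ℂ] Komega ω, IsDiagProj ω J Q → Commute P Q) ∧
  (∀ J ∈ 𝔓, ∀ u v : Fomega ω, u.1 ∈ J → v.1 ∈ J → Λ u = Λ v)
lemma wordProd_injective : Function.Injective (wordProd : List (Fin n) → FreeGroup (Fin n)) := by
  have wordProd_eq_mk (l : List (Fin n)) :
      wordProd l = FreeGroup.mk (l.map fun i => (i, true)) := by
    induction l with
    | nil => rfl
    | cons i l ih =>
      simp only [wordProd, List.map_cons, List.prod_cons] at ih ⊢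
      rw [ih, FreeGroup.of, FreeGroup.mul_mk]
      rfl
  have toWord_eq (l : List (Fin n)) : (wordProd l).toWord = l.map fun i => (i, true) := by
    rw [wordProd_eq_mk, FreeGroup.toWord_mk]
    refine FreeGroup.IsReduced.reduce_eq ?_
    rw [FreeGroup.IsReduced, List.isChain_map]
    exact List.Pairwise.isChain (List.pairwise_of_forall (by simp))
  intro l l' h
  have hmap : l.map (fun i => (i, true)) = l'.map fun i => (i, true) := by
    rw [← toWord_eq, ← toWord_eq, h]
  exact List.map_injective_iff.2 (fun i j hij => (Prod.mk.inj hij).1) hmap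

@[simp]
lemma wordProd_nil : wordProd ([] : List (Fin n)) = 1 := rfl

lemma wordProd_cons (i : Fin n) (l : List (Fin n)) :
    wordProd (i :: l) = FreeGroup.of i * wordProd l := by
  simp [wordProd]

lemma wordProd_append (l l' : List (Fin n)) :
    wordProd (l ++ l') = wordProd l * wordProd l' := by
  simp [wordProd]

lemma initSeg_add (ω : ℕ → Fin n) (m k : ℕ) :
    ∃ t : List (Fin n), t.length = k ∧ initSeg ω (m + k) = initSeg ω m ++ t :=
  ⟨List.ofFn fun j : Fin k => ω (m + j), by simp, by simp [initSeg, List.ofFn_add]⟩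

lemma exists_eq_mul_initSeg_add {ω : ℕ → Fin n} (v : List (Fin n)) (m k : ℕ) :
    ∃ t : List (Fin n), t.length = k ∧ wordProd v * (wordProd (initSeg ω m))⁻¹ =
      wordProd (v ++ t) * (wordProd (initSeg ω (m + k)))⁻¹ := by
  obtain ⟨t, ht, h⟩ := initSeg_add ω m k
  exact ⟨t, ht, by rw [h, wordProd_append, wordProd_append]; group⟩

section FomegaAction

variable {ω : ℕ → Fin n}

lemma exists_eq_gen (u : Fomega ω) : ∃ (i : Fin n) (u' : Fomega ω), u = gen ω i u' := by
  obtain ⟨_, v, m, rfl⟩ := u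
  obtain ⟨t, ht, h⟩ := exists_eq_mul_initSeg_add (ω := ω) v m 1
  obtain ⟨i, l, hl⟩ := List.exists_cons_of_length_pos (l := v ++ t) (by simp [ht])
  refine ⟨i, ⟨_, l, m + 1, rfl⟩, Subtype.ext ?_⟩
  exact h.trans (by rw [hl, wordProd_cons, mul_assoc]; rfl)

lemma gen_inj {i j : Fin n} {u v : Fomega ω} (h : gen ω i u = gen ω j v) : i = j ∧ u = v := by
  have hval : FreeGroup.of i * u.1 = FreeGroup.of j * v.1 := congrArg Subtype.val h
  have hij : i = j := by
    obtain ⟨_, a, m, rfl⟩ := u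
    obtain ⟨_, b, k, rfl⟩ := v
    obtain ⟨s, -, hs⟩ := exists_eq_mul_initSeg_add (ω := ω) a m k
    obtain ⟨t, -, ht⟩ := exists_eq_mul_initSeg_add (ω := ω) b k m
    simp only [hs, ht, add_comm k m, ← mul_assoc, ← wordProd_cons] at hval
    exact (List.cons.inj (wordProd_injective (mul_right_cancel hval))).1
  subst hij
  exact ⟨rfl, Subtype.ext (mul_left_cancel hval)⟩

/-- `wu` as an element of `F_ω`. -/
def genWord (ω : ℕ → Fin n) (w : List (Fin n)) (u : Fomega ω) : Fomega ω :=
  w.foldr (gen ω) u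

lemma genWord_cons (i : Fin n) (w : List (Fin n)) (u : Fomega ω) :
    genWord ω (i :: w) u = gen ω i (genWord ω w u) := rfl

lemma genWord_val (w : List (Fin n)) (u : Fomega ω) :
    (genWord ω w u).1 = wordProd w * u.1 := by
  induction w with
  | nil => simp [genWord]
  | cons i w ih =>
    rw [wordProd_cons, mul_assoc, ← ih]
    rfl

lemma exists_eq_genWord (m : ℕ) (u : Fomega ω) :
    ∃ (w : List (Fin n)) (u' : Fomega ω), w.length = m ∧ u = genWord ω w u' := by
  induction m generalizing u with
  | zero => exact ⟨[], u, rfl, rfl⟩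
  | succ m ih =>
    obtain ⟨i, u', rfl⟩ := exists_eq_gen u
    obtain ⟨w, u'', hw, rfl⟩ := ih u'
    exact ⟨i :: w, u'', by simp [hw], rfl⟩

lemma eq_of_genWord_eq {w w' : List (Fin n)} (hlen : w.length = w'.length) {u v : Fomega ω}
    (h : genWord ω w u = genWord ω w' v) : w = w' := by
  induction w generalizing w' with
  | nil => exact (List.length_eq_zero_iff.1 hlen.symm).symm
  | cons i w ih =>
    cases w' with
    | nil => simp at hlen
    | cons j w' =>
      obtain ⟨rfl, h'⟩ := gen_inj h
      rw [ih (by simpa using hlen) h']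

end FomegaAction

section Coordinates

variable {ω : ℕ → Fin n}

lemma xi_eq_single [DecidableEq (Fomega ω)] (u : Fomega ω) : xi ω u = lp.single 2 u 1 := by
  rw [xi]
  congr!

lemma xi_apply (u v : Fomega ω) : xi ω u v = if v = u then 1 else 0 := by
  by_cases h : v = u
  · subst h
    simp [xi]
  · rw [if_neg h]
    exact lp.single_apply_ne 2 u 1 h

lemma continuousLinearMap_ext_xi {F : Type*} [AddCommMonoid F] [Module ℂ F] [TopologicalSpace F]
    [T2Space F] {A B : Komega ω →L[ℂ] F} (h : ∀ u, A (xi ω u) = B (xi ω u)) : A = B := by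
  refine lp.ext_continuousLinearMap ENNReal.ofNat_ne_top fun u => ?_
  ext
  simpa [xi_eq_single] using h u

lemma shift_apply_gen {S : Fin n → Komega ω →L[ℂ] Komega ω}
    (hS : IsWeightedShiftR ω (fun _ => 1) S) (i : Fin n) (f : Komega ω) (u : Fomega ω) :
    S i f (gen ω i u) = f u := by
  have h : (lp.evalCLM ℂ (fun _ : Fomega ω => ℂ) 2 (gen ω i u)).comp (S i) =
      lp.evalCLM ℂ (fun _ : Fomega ω => ℂ) 2 u := by
    refine continuousLinearMap_ext_xi fun v => ?_
    have hiff : gen ω i u = gen ω i v ↔ u = v := ⟨fun h => (gen_inj h).2, fun h => h ▸ rfl⟩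
    change S i (xi ω v) (gen ω i u) = xi ω v u
    simp [hS i v, xi_apply, hiff]
  exact congr($h f)

lemma shift_apply_gen_of_ne {S : Fin n → Komega ω →L[ℂ] Komega ω}
    (hS : IsWeightedShiftR ω (fun _ => 1) S) {i j : Fin n} (hij : j ≠ i) (f : Komega ω)
    (u : Fomega ω) : S i f (gen ω j u) = 0 := by
  have h : (lp.evalCLM ℂ (fun _ : Fomega ω => ℂ) 2 (gen ω j u)).comp (S i) = 0 := by
    refine continuousLinearMap_ext_xi fun v => ?_
    have hne : gen ω j u ≠ gen ω i v := fun h => hij (gen_inj h).1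
    change S i (xi ω v) (gen ω j u) = 0
    simp [hS i v, xi_apply, hne]
  exact congr($h f)

lemma IsDiagProj.apply {A : Set (FreeGroup (Fin n))} {Q : Komega ω →L[ℂ] Komega ω}
    (hQ : IsDiagProj ω A Q) (f : Komega ω) (u : Fomega ω) :
    Q f u = if u.1 ∈ A then f u else 0 := by
  have h : (lp.evalCLM ℂ (fun _ : Fomega ω => ℂ) 2 u).comp Q =
      (if u.1 ∈ A then (1 : ℂ) else 0) • lp.evalCLM ℂ (fun _ : Fomega ω => ℂ) 2 u := by
    refine continuousLinearMap_ext_xi fun v => ?_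
    change Q (xi ω v) u = (if u.1 ∈ A then (1 : ℂ) else 0) * xi ω v u
    rw [hQ v]
    by_cases huv : u = v
    · subst huv
      split_ifs <;> simp
    · split_ifs <;> simp [xi_apply, huv]
  have hf : Q f u = (if u.1 ∈ A then (1 : ℂ) else 0) * f u := congr($h f)
  rw [hf, ite_mul, one_mul, zero_mul]

lemma exists_isDiagProj (ω : ℕ → Fin n) (A : Set (FreeGroup (Fin n))) :
    ∃ Q : Komega ω →L[ℂ] Komega ω, IsDiagProj ω A Q := by
  set M : Submodule ℂ (Komega ω) := Submodule.span ℂ (xi ω '' {u | u.1 ∉ A})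
  refine ⟨Mᗮ.starProjection, fun u => ?_⟩
  split_ifs with hu
  · refine Submodule.starProjection_eq_self_iff.2 ?_
    refine (Submodule.mem_orthogonal _ _).2 fun f hf => ?_
    induction hf using Submodule.span_induction with
    | mem f hf =>
      obtain ⟨v, hv, rfl⟩ := hf
      have hvu : v ≠ u := fun h => hv (h ▸ hu)
      have h := lp.inner_single_left (𝕜 := ℂ) v (1 : ℂ) (xi ω u)
      rw [xi_apply, if_neg hvu, inner_zero_right] at h
      rwa [xi_eq_single v]
    | zero => simp
    | add f g _ _ hf hg => rw [inner_add_left, hf, hg, add_zero]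
    | smul c f _ hf => rw [inner_smul_left, hf, mul_zero]
  · rw [Submodule.starProjection_apply_eq_zero_iff]
    exact M.le_orthogonal_orthogonal (Submodule.subset_span ⟨u, hu, rfl⟩)

/-- Two points of `F_ω` are linked by `P` when the corresponding matrix entry of `P` does not
vanish. -/
def Linked (P : Komega ω →L[ℂ] Komega ω) (u v : Fomega ω) : Prop := P (xi ω v) u ≠ 0

lemma commute_diagProj_iff {P Q : Komega ω →L[ℂ] Komega ω} {A : Set (FreeGroup (Fin n))}
    (hQ : IsDiagProj ω A Q) :
    Commute P Q ↔ ∀ u v : Fomega ω, Linked P u v → (u.1 ∈ A ↔ v.1 ∈ A) := by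
  have hPQ (u v : Fomega ω) : P (Q (xi ω v)) u = if v.1 ∈ A then P (xi ω v) u else 0 := by
    rw [hQ v]
    split_ifs <;> simp
  constructor
  · intro h u v huv
    have huv' : P (Q (xi ω v)) u = Q (P (xi ω v)) u := congr($(h.eq) (xi ω v) u)
    rw [hPQ, hQ.apply] at huv'
    rw [Linked] at huv
    split_ifs at huv' <;> simp_all
  · intro h
    refine continuousLinearMap_ext_xi fun v => lp.ext (funext fun u => ?_)
    change P (Q (xi ω v)) u = Q (P (xi ω v)) u
    rw [hPQ, hQ.apply]
    by_cases huv : P (xi ω v) u = 0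
    · simp [huv]
    · simp [h u v huv]

/-- The connected component of `u` for the relation `Linked P`. -/
def linkComponent (P : Komega ω →L[ℂ] Komega ω) (u : Fomega ω) : Set (FreeGroup (Fin n)) :=
  Subtype.val '' {v | Relation.EqvGen (Linked P) u v}

lemma mem_linkComponent {P : Komega ω →L[ℂ] Komega ω} {u v : Fomega ω} :
    v.1 ∈ linkComponent P u ↔ Relation.EqvGen (Linked P) u v := by
  simp [linkComponent]

lemma linkComponent_subset (P : Komega ω →L[ℂ] Komega ω) (u : Fomega ω) :
    linkComponent P u ⊆ Fomega ω := by
  rintro _ ⟨v, -, rfl⟩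
  exact v.2

lemma self_mem_linkComponent (P : Komega ω →L[ℂ] Komega ω) (u : Fomega ω) :
    u.1 ∈ linkComponent P u := mem_linkComponent.2 (.refl u)

lemma linkComponent_eq {P : Komega ω →L[ℂ] Komega ω} {u v : Fomega ω}
    (h : Relation.EqvGen (Linked P) u v) : linkComponent P u = linkComponent P v :=
  congrArg (Subtype.val '' ·) <| Set.ext fun _ => ⟨(h.symm _ _).trans _ _ _, h.trans _ _ _⟩

lemma mem_iff_of_eqvGen_linked {P : Komega ω →L[ℂ] Komega ω} {A : Set (FreeGroup (Fin n))}
    (hA : ∀ u v : Fomega ω, Linked P u v → (u.1 ∈ A ↔ v.1 ∈ A)) {u v : Fomega ω}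
    (h : Relation.EqvGen (Linked P) u v) : u.1 ∈ A ↔ v.1 ∈ A := by
  induction h with
  | rel u v huv => exact hA u v huv
  | refl => rfl
  | symm _ _ _ ih => exact ih.symm
  | trans _ _ _ _ _ ih₁ ih₂ => exact ih₁.trans ih₂

end Coordinates

section GoodPartition

variable {ω : ℕ → Fin n} {Λ : Fomega ω → ℝ} {P : Komega ω →L[ℂ] Komega ω}
  {𝔓 : Set (Set (FreeGroup (Fin n)))}

lemma GoodPartition.linkComponent_subset (h𝔓 : GoodPartition ω Λ P 𝔓)
    {J : Set (FreeGroup (Fin n))} (hJ : J ∈ 𝔓) {u : Fomega ω} (hu : u.1 ∈ J) :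
    linkComponent P u ⊆ J := by
  obtain ⟨Q, hQ⟩ := exists_isDiagProj ω J
  rintro _ ⟨v, hv, rfl⟩
  exact (mem_iff_of_eqvGen_linked ((commute_diagProj_iff hQ).1 (h𝔓.2.1 J hJ Q hQ)) hv).1 hu

lemma GoodPartition.range_linkComponent (h𝔓 : GoodPartition ω Λ P 𝔓) :
    GoodPartition ω Λ P (Set.range (linkComponent P)) := by
  refine ⟨⟨?_, ?_⟩, ?_, ?_⟩
  · rintro _ ⟨u, rfl⟩
    exact ⟨⟨u.1, self_mem_linkComponent P u⟩, _root_.linkComponent_subset P u⟩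
  · intro g hg
    refine ⟨linkComponent P ⟨g, hg⟩, ⟨⟨_, rfl⟩, self_mem_linkComponent P ⟨g, hg⟩⟩, ?_⟩
    rintro _ ⟨⟨u, rfl⟩, hgu⟩
    exact linkComponent_eq (mem_linkComponent (v := ⟨g, hg⟩).1 hgu)
  · rintro _ ⟨u, rfl⟩ Q hQ
    refine (commute_diagProj_iff hQ).2 fun v w hvw => ?_
    rw [mem_linkComponent, mem_linkComponent]
    exact ⟨fun h => h.trans _ _ _ (.rel _ _ hvw),
      fun h => h.trans _ _ _ (.symm _ _ (.rel _ _ hvw))⟩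
  · rintro _ ⟨u, rfl⟩ v w hv hw
    obtain ⟨J, ⟨hJ, huJ⟩, -⟩ := h𝔓.1.2 u.1 u.2
    have hsub := h𝔓.linkComponent_subset hJ huJ
    exact h𝔓.2.2 J hJ v w (hsub hv) (hsub hw)

lemma GoodPartition.range_linkComponent_refines (h𝔓 : GoodPartition ω Λ P 𝔓) :
    RefinesPartition (Set.range (linkComponent P)) 𝔓 := by
  intro J hJ
  refine ⟨{I | I ∈ Set.range (linkComponent P) ∧ I ⊆ J}, fun I hI => hI.1, ?_⟩
  refine Set.Subset.antisymm (fun g hg => ?_) (Set.sUnion_subset fun I hI => hI.2)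
  have hgω : g ∈ Fomega ω := (h𝔓.1.1 J hJ).2 hg
  exact ⟨linkComponent P ⟨g, hgω⟩, ⟨⟨_, rfl⟩, h𝔓.linkComponent_subset hJ hg⟩,
    self_mem_linkComponent P ⟨g, hgω⟩⟩

end GoodPartition

section ShiftInvariance

variable {ω : ℕ → Fin n} {S : Fin n → Komega ω →L[ℂ] Komega ω} {P : Komega ω →L[ℂ] Komega ω}

lemma linked_gen_iff (hS : IsWeightedShiftR ω (fun _ => 1) S) (hPS : ∀ i, Commute P (S i))
    {i j : Fin n} {u v : Fomega ω} :
    Linked P (gen ω j u) (gen ω i v) ↔ j = i ∧ Linked P u v := by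
  have h : P (xi ω (gen ω i v)) = S i (P (xi ω v)) := by
    have hSv : S i (xi ω v) = xi ω (gen ω i v) := by simp [hS i v]
    rw [← hSv]
    exact congr($((hPS i).eq) (xi ω v))
  by_cases hij : j = i
  · subst hij
    simp [Linked, h, shift_apply_gen hS]
  · simp [Linked, h, hij, shift_apply_gen_of_ne hS hij]

lemma eqvGen_linked_gen (hS : IsWeightedShiftR ω (fun _ => 1) S) (hPS : ∀ i, Commute P (S i))
    (i : Fin n) {u v : Fomega ω} (h : Relation.EqvGen (Linked P) u v) :
    Relation.EqvGen (Linked P) (gen ω i u) (gen ω i v) := by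
  induction h with
  | rel u v huv => exact .rel _ _ ((linked_gen_iff hS hPS).2 ⟨rfl, huv⟩)
  | refl => exact .refl _
  | symm _ _ _ ih => exact ih.symm _ _
  | trans _ _ _ _ _ ih₁ ih₂ => exact ih₁.trans _ _ _ ih₂

lemma exists_gen_of_eqvGen_linked (hS : IsWeightedShiftR ω (fun _ => 1) S)
    (hPS : ∀ i, Commute P (S i)) {u v : Fomega ω} (h : Relation.EqvGen (Linked P) u v) :
    ∃ (i : Fin n) (u' v' : Fomega ω),
      u = gen ω i u' ∧ v = gen ω i v' ∧ Relation.EqvGen (Linked P) u' v' := by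
  induction h with
  | rel u v huv =>
    obtain ⟨i, u', rfl⟩ := exists_eq_gen u
    obtain ⟨j, v', rfl⟩ := exists_eq_gen v
    obtain ⟨rfl, huv'⟩ := (linked_gen_iff hS hPS).1 huv
    exact ⟨i, u', v', rfl, rfl, .rel _ _ huv'⟩
  | refl u =>
    obtain ⟨i, u', rfl⟩ := exists_eq_gen u
    exact ⟨i, u', u', rfl, rfl, .refl _⟩
  | symm _ _ _ ih =>
    obtain ⟨i, u', v', hu, hv, h⟩ := ih
    exact ⟨i, v', u', hv, hu, h.symm _ _⟩
  | trans _ _ _ _ _ ih₁ ih₂ =>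
    obtain ⟨i, u', v', hu, rfl, h⟩ := ih₁
    obtain ⟨j, v'', w', hv, hw, h'⟩ := ih₂
    obtain ⟨rfl, rfl⟩ := gen_inj hv
    exact ⟨i, u', w', hu, hw, h.trans _ _ _ h'⟩

lemma linkComponent_gen (hS : IsWeightedShiftR ω (fun _ => 1) S)
    (hPS : ∀ i, Commute P (S i)) (i : Fin n) (u : Fomega ω) :
    linkComponent P (gen ω i u) = (fun g => FreeGroup.of i * g) '' linkComponent P u := by
  ext g
  constructor
  · rintro ⟨v, hv, rfl⟩
    obtain ⟨j, u', v', hu, rfl, h⟩ := exists_gen_of_eqvGen_linked hS hPS hv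
    obtain ⟨rfl, rfl⟩ := gen_inj hu
    exact ⟨v'.1, mem_linkComponent.2 h, rfl⟩
  · rintro ⟨_, ⟨v, hv, rfl⟩, rfl⟩
    exact ⟨gen ω i v, eqvGen_linked_gen hS hPS i hv, rfl⟩

lemma linkComponent_genWord (hS : IsWeightedShiftR ω (fun _ => 1) S)
    (hPS : ∀ i, Commute P (S i)) (w : List (Fin n)) (u : Fomega ω) :
    linkComponent P (genWord ω w u) = mulSet w (linkComponent P u) := by
  induction w with
  | nil => simp [genWord, mulSet]
  | cons i w ih =>
    rw [genWord_cons, linkComponent_gen hS hPS, ih, mulSet, mulSet, Set.image_image]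
    simp only [wordProd_cons, mul_assoc]

end ShiftInvariance

lemma preSet_mulSet {ω : ℕ → Fin n} (w : List (Fin n)) {A : Set (FreeGroup (Fin n))}
    (hA : A ⊆ Fomega ω) : preSet ω w (mulSet w A) = A := by
  ext g
  simp only [preSet, mulSet, Set.mem_image, mul_right_inj, exists_eq_right, Set.mem_ofPred_eq]
  exact ⟨fun h => h.2, fun h => ⟨hA h, h⟩⟩

lemma eq_of_preSet_mulSet_nonempty {ω : ℕ → Fin n} {w w' : List (Fin n)}
    (hlen : w'.length = w.length) {A : Set (FreeGroup (Fin n))} (hA : A ⊆ Fomega ω)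
    (h : (preSet ω w' (mulSet w A)).Nonempty) : w' = w := by
  obtain ⟨g, hg, a, ha, hag⟩ := h
  refine eq_of_genWord_eq (ω := ω) hlen (u := ⟨g, hg⟩) (v := ⟨a, hA ha⟩) (Subtype.ext ?_)
  rw [genWord_val, genWord_val]
  exact hag.symm

/-- for a maximal partition `𝔓` with properties (a) and (b), each `J ∈ 𝔓`
admits, for each `m ≥ 0`, a unique word `w` of length `m` with `w⁻¹J ∩ F_ω ≠ ∅`; moreover
`w(w⁻¹J ∩ F_ω) = J` and the sets `v(w⁻¹J ∩ F_ω)` meeting a member of `𝔓` coincide with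
that member. -/
theorem maximal_partition_minimal_projections
    {n : ℕ} (hn : 2 ≤ n) (ω : ℕ → Fin n)
    (Λ : Fomega ω → ℝ) (hbdd : ∃ C : ℝ, ∀ u, ‖Λ u‖ ≤ C) (hpos : ∀ u, 0 < Λ u)
    (S : Fin n → Komega ω →L[ℂ] Komega ω) (hS : IsWeightedShiftR ω (fun _ => 1) S)
    (P : Komega ω →L[ℂ] Komega ω) (hPsa : IsSelfAdjoint P) (hPidem : P * P = P)
    (hPS : ∀ i : Fin n, Commute P (S i))
    (𝔓 : Set (Set (FreeGroup (Fin n)))) (hgood : GoodPartition ω Λ P 𝔓)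
    (hmax : ∀ 𝔓' : Set (Set (FreeGroup (Fin n))),
      GoodPartition ω Λ P 𝔓' → RefinesPartition 𝔓' 𝔓 → 𝔓' = 𝔓) :
    ∀ J ∈ 𝔓, ∀ m : ℕ,
      (∃! w : List (Fin n), w.length = m ∧ (preSet ω w J).Nonempty) ∧
      ∀ w : List (Fin n), w.length = m → (preSet ω w J).Nonempty →
        mulSet w (preSet ω w J) = J ∧
        ∀ v : List (Fin n), ∀ J₁ ∈ 𝔓, (mulSet v (preSet ω w J) ∩ J₁).Nonempty →
          mulSet v (preSet ω w J) = J₁ := by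
  obtain rfl : Set.range (linkComponent P) = 𝔓 :=
    hmax _ hgood.range_linkComponent hgood.range_linkComponent_refines
  rintro _ ⟨u, rfl⟩ m
  obtain ⟨w, u, hw, rfl⟩ := exists_eq_genWord m u
  have hsub := linkComponent_subset P u
  rw [linkComponent_genWord hS hPS]
  refine ⟨⟨w, ⟨hw, ?_⟩, ?_⟩, ?_⟩
  · rw [preSet_mulSet w hsub]
    exact ⟨u.1, self_mem_linkComponent P u⟩
  · rintro w' ⟨hw', hne⟩
    exact eq_of_preSet_mulSet_nonempty (hw'.trans hw.symm) hsub hne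
  · intro w' hw' hne
    obtain rfl := eq_of_preSet_mulSet_nonempty (hw'.trans hw.symm) hsub hne
    rw [preSet_mulSet w' hsub]
    refine ⟨rfl, fun v J₁ hJ₁ ⟨g, hg, hgJ₁⟩ => ?_⟩
    rw [← linkComponent_genWord hS hPS] at hg ⊢
    exact (hgood.1.2 g (linkComponent_subset P _ hg)).unique ⟨⟨_, rfl⟩, hg⟩ ⟨hJ₁, hgJ₁⟩
end
end
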